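/- arXiv:2202.05073 — 2 statements merged into one kernel-verified Lean document; each statement's English description precedes it below -/
import Mathlib

section
/- Let X and Y be real Banach spaces, let x̃ ∈ X, let r⋆ > 0, and let B̄ denote the closed ball of radius r⋆ centered at x̃. Let F : X → Y be Fréchet differentiable at every point of B̄, let A : Y → X be a continuous linear map, and define T : X → X by T(x) = x − A(F(x)). Suppose Y₀ and Z are nonnegative real numbers such that ‖A(F(x̃))‖ ≤ Y₀, such that for every x ∈ B̄ the operator norm of (id_X − A ∘ DF(x)) is at most Z / r⋆, and such that Y₀ + Z − r⋆ < 0. Then T maps B̄ into B̄, T is Lipschitz on B̄ with Lipschitz constant Z/r⋆ < 1, and T has a unique fixed point in B̄. -/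
/-- **Radii polynomial theorem (contraction form).**
`xN` plays the role of the numerical approximation `x̃` and `rStar` of the radius `r⋆`.
If `Y₀` bounds the defect `‖A (F x̃)‖` and `Z / r⋆` bounds the operator norm of
`id - A ∘ DF x` on the closed ball of radius `r⋆` around `x̃`, and the radii
polynomial value `Y₀ + Z - r⋆` is negative, then the approximate Newton operator
`T x = x - A (F x)` maps the ball into itself, is Lipschitz there with constant
`Z / r⋆ < 1`, and has a unique fixed point in the ball. -/
theorem radii_polynomial_contraction
    {X Y : Type*} [NormedAddCommGroup X] [NormedSpace ℝ X] [CompleteSpace X]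
    [NormedAddCommGroup Y] [NormedSpace ℝ Y] [CompleteSpace Y]
    (xN : X) (rStar : ℝ) (hr : 0 < rStar)
    (F : X → Y) (DF : X → X →L[ℝ] Y)
    (hF : ∀ x ∈ Metric.closedBall xN rStar, HasFDerivAt F (DF x) x)
    (A : Y →L[ℝ] X) (T : X → X) (hT : ∀ x, T x = x - A (F x))
    (Y₀ Z : ℝ) (hY₀ : 0 ≤ Y₀) (hZ : 0 ≤ Z)
    (hYbound : ‖A (F xN)‖ ≤ Y₀)
    (hZbound : ∀ x ∈ Metric.closedBall xN rStar,
      ‖ContinuousLinearMap.id ℝ X - A.comp (DF x)‖ ≤ Z / rStar)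
    (hpoly : Y₀ + Z - rStar < 0) :
    Set.MapsTo T (Metric.closedBall xN rStar) (Metric.closedBall xN rStar) ∧
    LipschitzOnWith (Z / rStar).toNNReal T (Metric.closedBall xN rStar) ∧
    Z / rStar < 1 ∧
    ∃! x, x ∈ Metric.closedBall xN rStar ∧ T x = x := by
  have hlt : Z / rStar < 1 := (div_lt_one hr).2 (by linarith)
  have hK : 0 ≤ Z / rStar := div_nonneg hZ hr.le
  obtain rfl : T = fun x ↦ x - A (F x) := funext hT
  have hderiv : ∀ x ∈ Metric.closedBall xN rStar,
      HasFDerivWithinAt (fun x ↦ x - A (F x)) (ContinuousLinearMap.id ℝ X - A.comp (DF x))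
        (Metric.closedBall xN rStar) x := fun x hx ↦
    ((hasFDerivAt_id x).sub (A.hasFDerivAt.comp x (hF x hx))).hasFDerivWithinAt
  have hlip : LipschitzOnWith (Z / rStar).toNNReal (fun x ↦ x - A (F x))
      (Metric.closedBall xN rStar) := by
    refine LipschitzOnWith.of_dist_le_mul fun x hx y hy ↦ ?_
    rw [dist_eq_norm, dist_eq_norm, Real.coe_toNNReal _ hK]
    exact (convex_closedBall xN rStar).norm_image_sub_le_of_norm_hasFDerivWithin_le
      hderiv hZbound hy hx
  have hcenter : xN ∈ Metric.closedBall xN rStar := Metric.mem_closedBall_self hr.le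
  have hmaps : Set.MapsTo (fun x ↦ x - A (F x)) (Metric.closedBall xN rStar)
      (Metric.closedBall xN rStar) := by
    intro x hx
    have hdist := hlip.dist_le_mul x hx xN hcenter
    rw [Real.coe_toNNReal _ hK] at hdist
    have hdefect : dist (xN - A (F xN)) xN ≤ Y₀ := by
      simpa [dist_eq_norm] using hYbound
    have hscale : Z / rStar * dist x xN ≤ Z :=
      (mul_le_mul_of_nonneg_left hx hK).trans_eq (div_mul_cancel₀ Z hr.ne')
    have htri := dist_triangle (x - A (F x)) (xN - A (F xN)) xN
    rw [Metric.mem_closedBall]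
    linarith
  have hcontr : ContractingWith (Z / rStar).toNNReal (hmaps.restrict _ _ _) :=
    ⟨Real.toNNReal_lt_one.2 hlt, hlip.mapsToRestrict hmaps⟩
  obtain ⟨x, hx, hfix, -⟩ := hcontr.exists_fixedPoint'
    Metric.isClosed_closedBall.isComplete hmaps hcenter (edist_ne_top _ _)
  refine ⟨hmaps, hlip, hlt, x, ⟨hx, hfix⟩, fun y ⟨hy, hyfix⟩ ↦ ?_⟩
  exact congrArg Subtype.val (hcontr.fixedPoint_unique' (x := ⟨y, hy⟩) (y := ⟨x, hx⟩)
    (Subtype.ext hyfix) (Subtype.ext hfix))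
end

section
/- Let X and Y be real Banach spaces, let x̃ ∈ X, r⋆ > 0, and B̄ the closed ball of radius r⋆ centered at x̃. Let F : X → Y be Fréchet differentiable at every point of B̄, let A : Y → X be a continuous injective linear map, and define T(x) = x − A(F(x)). Suppose Y₀, Z ≥ 0 satisfy ‖A(F(x̃))‖ ≤ Y₀, the operator norm of (id_X − A ∘ DF(x)) is at most Z/r⋆ for every x ∈ B̄, and Y₀ + Z − r⋆ < 0. Then there exists a unique x⋆ ∈ B̄ such that F(x⋆) = 0. -/
open Metric Set in
/-- A map that is contracting on a closed ball and moves its center by little enough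
has a unique fixed point in that ball. -/
theorem existsUnique_isFixedPt_closedBall {E : Type*} [MetricSpace E] [CompleteSpace E]
    {f : E → E} {c : E} {r : ℝ} {K : NNReal} (hK : K < 1)
    (hf : LipschitzOnWith K f (closedBall c r)) (hc : dist (f c) c + K * r ≤ r) (hr : 0 ≤ r) :
    ∃! x, x ∈ closedBall c r ∧ Function.IsFixedPt f x := by
  have hmaps : MapsTo f (closedBall c r) (closedBall c r) := fun x hx ↦ by
    have hlip : dist (f x) (f c) ≤ K * r :=
      (hf.dist_le_mul x hx c (mem_closedBall_self hr)).trans (by gcongr; exact hx)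
    rw [mem_closedBall]
    linarith [dist_triangle (f x) (f c) c]
  have hcontr : ContractingWith K (hmaps.restrict f _ _) :=
    ⟨hK, hf.mapsToRestrict hmaps⟩
  obtain ⟨x, hx, hfx, -⟩ := hcontr.exists_fixedPoint' isClosed_closedBall.isComplete hmaps
    (mem_closedBall_self hr) (edist_ne_top _ _)
  refine ⟨x, ⟨hx, hfx⟩, fun y ⟨hy, hfy⟩ ↦ ?_⟩
  exact congrArg Subtype.val (hcontr.fixedPoint_unique' (x := ⟨y, hy⟩) (y := ⟨x, hx⟩)
    (Subtype.ext hfy) (Subtype.ext hfx))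

/-- **Radii polynomial theorem (zero-finding form).**
`xN` plays the role of the numerical approximation `x̃` and `rStar` of the radius `r⋆`.
With the radii polynomial bounds `Y₀`, `Z` satisfying `Y₀ + Z - r⋆ < 0`, and the
continuous linear map `A` injective, the map `F` has a unique zero in the closed
ball of radius `r⋆` around the numerical approximation `x̃`. -/
theorem radii_polynomial_zero_finding
    {X Y : Type*} [NormedAddCommGroup X] [NormedSpace ℝ X] [CompleteSpace X]
    [NormedAddCommGroup Y] [NormedSpace ℝ Y] [CompleteSpace Y]
    (xN : X) (rStar : ℝ) (hr : 0 < rStar)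
    (F : X → Y) (DF : X → X →L[ℝ] Y)
    (hF : ∀ x ∈ Metric.closedBall xN rStar, HasFDerivAt F (DF x) x)
    (A : Y →L[ℝ] X) (hA : Function.Injective A)
    (T : X → X) (hT : ∀ x, T x = x - A (F x))
    (Y₀ Z : ℝ) (hY₀ : 0 ≤ Y₀) (hZ : 0 ≤ Z)
    (hYbound : ‖A (F xN)‖ ≤ Y₀)
    (hZbound : ∀ x ∈ Metric.closedBall xN rStar,
      ‖ContinuousLinearMap.id ℝ X - A.comp (DF x)‖ ≤ Z / rStar)
    (hpoly : Y₀ + Z - rStar < 0) :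
    ∃! x, x ∈ Metric.closedBall xN rStar ∧ F x = 0 := by
  have hder : ∀ x ∈ Metric.closedBall xN rStar, HasFDerivWithinAt T
      (ContinuousLinearMap.id ℝ X - A.comp (DF x)) (Metric.closedBall xN rStar) x := fun x hx ↦ by
    rw [funext hT]
    exact ((hasFDerivAt_id x).sub (A.hasFDerivAt.comp x (hF x hx))).hasFDerivWithinAt
  have hlip : LipschitzOnWith (.mk (Z / rStar) (by positivity)) T (Metric.closedBall xN rStar) :=
    (convex_closedBall xN rStar).lipschitzOnWith_of_nnnorm_hasFDerivWithin_le hder hZbound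
  have hfix : ∀ x, Function.IsFixedPt T x ↔ F x = 0 := fun x ↦ by
    rw [Function.IsFixedPt, hT, sub_eq_self, map_eq_zero_iff A hA]
  simp only [← hfix]
  refine existsUnique_isFixedPt_closedBall ?_ hlip ?_ hr.le
  · rw [← NNReal.coe_lt_coe, NNReal.coe_mk, NNReal.coe_one, div_lt_one hr]
    linarith
  · rw [NNReal.coe_mk, div_mul_cancel₀ Z hr.ne', hT, dist_eq_norm, sub_sub_cancel_left, norm_neg]
    linarith
end
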